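/- Let p be a prime, and let d_1, ..., d_n be integers none of which is divisible by p, with 2n + 1 ≤ p. Then there exists a function f : ℤ → ℤ (a perfect pairing on a subset of ℤ) given as follows: there exist residues x_1, ..., x_n, y_1, ..., y_n, pairwise distinct mod p, with x_i + d_i ≡ y_i (mod p), and the involution pairing each z ≡ x_i (mod p) with z + d_i (and each z ≡ y_i (mod p) with z - d_i) has the property that every arithmetic progression of length p+1 with difference d_i (for any i) contains two consecutive terms that are paired to each other. -/

import Mathlib

open Finset in
theorem aux_pow_sum {p : ℕ} [Fact p.Prime] (m : ℕ) (hm : m ≤ p - 1) :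
    ∑ x : ZMod p, x ^ m = if m = p - 1 then -1 else 0 := by
  have hp := (Fact.out : p.Prime).two_le
  split_ifs with h
  · subst h
    have h1 : ∀ x : ZMod p, x ^ (p - 1) = 1 - if x = 0 then 1 else 0 := by
      intro x
      split_ifs with hx
      · subst hx
        rw [zero_pow (by omega)]; ring
      · rw [ZMod.pow_card_sub_one_eq_one hx]; ring
    simp [h1, Finset.sum_sub_distrib]
  · apply FiniteField.sum_pow_lt_card_sub_one
    rw [ZMod.card]; omega

open Finset in
theorem aux_S {p : ℕ} [Fact p.Prime] (m l : ℕ) (hml : m + l ≤ p) (d : ZMod p) :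
    ∑ x : ZMod p, x ^ m * ((x + d) ^ l - x ^ l) = if m + l = p then -(l : ZMod p) * d else 0 := by
  have hp := (Fact.out : p.Prime).two_le
  have h1 : ∀ x : ZMod p, x ^ m * ((x + d) ^ l - x ^ l)
      = ∑ j ∈ range l, x ^ (m + j) * (d ^ (l - j) * (l.choose j : ZMod p)) := by
    intro x
    rw [add_pow, Finset.sum_range_succ]
    simp only [Nat.sub_self, pow_zero, Nat.choose_self, Nat.cast_one, mul_one, add_sub_cancel_right,
      Finset.mul_sum]
    refine Finset.sum_congr rfl fun j _ => ?_
    rw [pow_add]; ring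
  simp only [h1]
  rw [Finset.sum_comm]
  simp only [← Finset.sum_mul]
  have h2 : ∀ j ∈ range l, (∑ x : ZMod p, x ^ (m + j)) * (d ^ (l - j) * (l.choose j : ZMod p))
      = (if m + j = p - 1 then -1 else 0) * (d ^ (l - j) * (l.choose j : ZMod p)) := by
    intro j hj
    rw [mem_range] at hj
    rw [aux_pow_sum _ (by omega)]
  rw [Finset.sum_congr rfl h2]
  cases l with
  | zero => simp
  | succ l =>
    rw [Finset.sum_range_succ, Finset.sum_eq_zero]
    · have : (m + l = p - 1) ↔ (m + (l + 1) = p) := by omega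
      simp only [this]
      split_ifs
      · simp [Nat.choose_succ_self_right]; ring
      · simp
    · intro j hj
      rw [mem_range] at hj
      rw [if_neg (by omega), zero_mul]

/-- column exponents -/
def auxE (n : ℕ) (c : Fin n × Bool) : ℕ := if c.2 then 2 * n - 1 - c.1 else c.1

theorem auxE_flip (n : ℕ) (c c' : Fin n × Bool) :
    auxE n c + auxE n c' = 2 * n - 1 ↔ c' = (c.1, !c.2) := by
  obtain ⟨⟨a, ha⟩, b⟩ := c
  obtain ⟨⟨a', ha'⟩, b'⟩ := c'
  cases b <;> cases b' <;> simp [auxE] <;> omega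

theorem auxE_sum (n : ℕ) : ∑ c : Fin n × Bool, auxE n c = n * (2 * n - 1) := by
  rw [Fintype.sum_prod_type]
  have : ∀ i : Fin n, ∑ b : Bool, auxE n (i, b) = 2 * n - 1 := by
    intro i
    have := i.2
    simp [auxE]; omega
  rw [Finset.sum_congr rfl fun i _ => this i]
  simp

/-- The structured permutations. -/
def auxPerm (n : ℕ) (q : Equiv.Perm (Fin n) × (Fin n → Equiv.Perm Bool)) :
    Equiv.Perm (Fin n × Bool) :=
  Equiv.prodCongrLeft (fun _ : Bool => q.1) * Equiv.prodCongrRight q.2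

theorem auxPerm_apply (n : ℕ) (q : Equiv.Perm (Fin n) × (Fin n → Equiv.Perm Bool))
    (i : Fin n) (b : Bool) : auxPerm n q (i, b) = (q.1 i, q.2 i b) := rfl

theorem auxPerm_sign (n : ℕ) (q : Equiv.Perm (Fin n) × (Fin n → Equiv.Perm Bool)) :
    Equiv.Perm.sign (auxPerm n q) = ∏ i, Equiv.Perm.sign (q.2 i) := by
  rw [auxPerm, Equiv.Perm.sign_mul, Equiv.Perm.sign_prodCongrLeft, Equiv.Perm.sign_prodCongrRight]
  simp

theorem auxPerm_inj (n : ℕ) : Function.Injective (auxPerm n) := by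
  intro q q' h
  have h1 : ∀ i b, (q.1 i, q.2 i b) = (q'.1 i, q'.2 i b) := fun i b => by
    rw [← auxPerm_apply, ← auxPerm_apply, h]
  refine Prod.ext (Equiv.ext fun i => ?_) (funext fun i => Equiv.ext fun b => ?_)
  · exact (Prod.mk.inj (h1 i true)).1
  · exact (Prod.mk.inj (h1 i b)).2

theorem auxPerm_surj (n : ℕ) (σ : Equiv.Perm (Fin n × Bool))
    (h : ∀ i, σ (i, true) = ((σ (i, false)).1, !(σ (i, false)).2)) :
    ∃ q, auxPerm n q = σ := by
  have hinj : Function.Injective (fun i => (σ (i, false)).1) := by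
    intro i i' hii
    simp only at hii
    by_cases hb : (σ (i, false)).2 = (σ (i', false)).2
    · have := σ.injective (Prod.ext hii hb)
      exact (Prod.mk.inj this).1
    · have h2 : σ (i, false) = σ (i', true) := by
        rw [h i']
        refine Prod.ext hii ?_
        revert hb
        cases (σ (i, false)).2 <;> cases (σ (i', false)).2 <;> simp
      have := σ.injective h2
      exact (Prod.mk.inj this).1
  have hinj2 : ∀ i, Function.Injective (fun b => (σ (i, b)).2) := by
    intro i b b'
    have := h i
    cases b <;> cases b' <;> simp [this]
  refine ⟨(Equiv.ofBijective _ (Finite.injective_iff_bijective.1 hinj),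
    fun i => Equiv.ofBijective _ (Finite.injective_iff_bijective.1 (hinj2 i))), ?_⟩
  ext1 ⟨i, b⟩
  rw [auxPerm_apply]
  refine Prod.ext ?_ rfl
  cases b
  · rfl
  · simp [h i]

theorem auxBoolSum {F : Type*} [CommRing F] (f : Bool → F) :
    ∑ e : Equiv.Perm Bool, ((Equiv.Perm.sign e : ℤ) : F) * f (e true) = f true - f false := by
  have : (Finset.univ : Finset (Equiv.Perm Bool)) = {1, Equiv.swap true false} := by decide
  rw [this, Finset.sum_pair (by decide)]
  rw [Equiv.Perm.sign_swap (by decide)]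
  simp; ring

theorem aux_main {p : ℕ} [Fact p.Prime] (n : ℕ) (hpn : 2 * n + 1 ≤ p)
    (d : Fin n → ZMod p) (hd : ∀ i, d i ≠ 0) :
    ∃ x : Fin n → ZMod p, Function.Injective (Sum.elim x (fun i => x i + d i)) := by
  classical
  let v : (Fin n → ZMod p) → Fin n × Bool → ZMod p :=
    fun x r => if r.2 then x r.1 + d r.1 else x r.1
  let V : (Fin n → ZMod p) → Matrix (Fin n × Bool) (Fin n × Bool) (ZMod p) :=
    fun x => Matrix.of fun r c => v x r ^ auxE n c
  let N : (Fin n → ZMod p) → Matrix (Fin n × Bool) (Fin n × Bool) (ZMod p) :=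
    fun x => Matrix.of fun r c => if r.2 then (x r.1 + d r.1) ^ auxE n c - x r.1 ^ auxE n c
      else x r.1 ^ auxE n c
  let L : Matrix (Fin n × Bool) (Fin n × Bool) (ZMod p) :=
    Matrix.of fun r s => if r.1 = s.1 then (if r.2 = s.2 then 1 else if r.2 then -1 else 0) else 0
  have hNL : ∀ x, N x = L * V x := by
    intro x
    ext ⟨i, b⟩ c
    rw [Matrix.mul_apply, Fintype.sum_prod_type]
    cases b <;> simp [N, L, V, v, Finset.sum_add_distrib] <;> ring
  have key : ∃ x, (N x).det ≠ 0 := by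
    by_contra hcon
    push Not at hcon
    have hS : ∑ x : Fin n → ZMod p, (N x).det * ∏ i, x i ^ (p + 1 - 2 * n) = 0 := by
      simp [hcon]
    have hexp : ∀ x : Fin n → ZMod p, (N x).det * ∏ i, x i ^ (p + 1 - 2 * n)
        = ∑ σ : Equiv.Perm (Fin n × Bool), ((Equiv.Perm.sign σ : ℤ) : ZMod p) *
          ∏ i, (x i ^ (auxE n (σ (i, false)) + (p + 1 - 2 * n)) *
            ((x i + d i) ^ auxE n (σ (i, true)) - x i ^ auxE n (σ (i, true)))) := by
      intro x
      rw [← Matrix.det_transpose, Matrix.det_apply', Finset.sum_mul]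
      refine Finset.sum_congr rfl fun σ _ => ?_
      rw [mul_assoc, Fintype.prod_prod_type, ← Finset.prod_mul_distrib]
      congr 1
      refine Finset.prod_congr rfl fun i _ => ?_
      simp [N, pow_add]; ring
    simp only [hexp] at hS
    rw [Finset.sum_comm] at hS
    simp only [← Finset.mul_sum] at hS
    have hswap : ∀ σ : Equiv.Perm (Fin n × Bool), ∑ x : Fin n → ZMod p,
          ∏ i, (x i ^ (auxE n (σ (i, false)) + (p + 1 - 2 * n)) *
            ((x i + d i) ^ auxE n (σ (i, true)) - x i ^ auxE n (σ (i, true))))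
        = ∏ i, if σ (i, true) = ((σ (i, false)).1, !(σ (i, false)).2) then
            -(auxE n (σ (i, true)) : ZMod p) * d i else 0 := by
      intro σ
      have h0 := Finset.prod_univ_sum (fun _ : Fin n => (Finset.univ : Finset (ZMod p)))
        (fun i x => (x ^ (auxE n (σ (i, false)) + (p + 1 - 2 * n)) *
            ((x + d i) ^ auxE n (σ (i, true)) - x ^ auxE n (σ (i, true)))))
      rw [Fintype.piFinset_univ] at h0
      rw [← h0]
      by_cases hle : ∀ i, auxE n (σ (i, false)) + auxE n (σ (i, true)) ≤ 2 * n - 1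
      · refine Finset.prod_congr rfl fun i _ => ?_
        have hi := hle i
        have hn := i.2
        rw [aux_S _ _ (by omega)]
        refine if_congr ?_ rfl rfl
        rw [← auxE_flip]; omega
      · have hsum : ∑ i, (auxE n (σ (i, false)) + auxE n (σ (i, true))) = ∑ i : Fin n, (2 * n - 1) := by
          have h3 : ∑ c, auxE n (σ c) = ∑ c, auxE n c := Equiv.sum_comp σ (auxE n)
          rw [auxE_sum, Fintype.sum_prod_type] at h3
          simp only [Fintype.sum_bool] at h3
          simp only [Finset.sum_const, Finset.card_univ, Fintype.card_fin, smul_eq_mul]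
          rw [← h3]
          exact Finset.sum_congr rfl fun i _ => add_comm _ _
        have hlt : ∃ i, auxE n (σ (i, false)) + auxE n (σ (i, true)) < 2 * n - 1 := by
          by_contra hge
          push Not at hge hle
          obtain ⟨i, hi⟩ := hle
          exact absurd hsum (ne_of_gt (Finset.sum_lt_sum (fun j _ => hge j) ⟨i, Finset.mem_univ _, hi⟩))
        obtain ⟨i, hi⟩ := hlt
        rw [Finset.prod_eq_zero (Finset.mem_univ i), Finset.prod_eq_zero (Finset.mem_univ i)]
        · rw [if_neg]
          rw [← auxE_flip]; omega
        · have hn := i.2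
          rw [aux_S _ _ (by omega), if_neg (by omega)]
    simp only [hswap] at hS
    have hre : ∑ q : Equiv.Perm (Fin n) × (Fin n → Equiv.Perm Bool),
        ∏ i, (((Equiv.Perm.sign (q.2 i) : ℤ) : ZMod p) *
          (-(auxE n (q.1 i, q.2 i true) : ZMod p) * d i)) = 0 := by
      rw [← hS]
      refine Finset.sum_of_injOn (auxPerm n) (auxPerm_inj n).injOn (by simp) ?_ ?_
      · intro σ _ hσ
        have : ∃ i, ¬ σ (i, true) = ((σ (i, false)).1, !(σ (i, false)).2) := by
          by_contra hall
          push Not at hall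
          obtain ⟨q, hq⟩ := auxPerm_surj n σ hall
          exact hσ ⟨q, by simp, hq⟩
        obtain ⟨i, hi⟩ := this
        rw [Finset.prod_eq_zero (Finset.mem_univ i) (if_neg hi), mul_zero]
      · intro q _
        rw [Finset.prod_mul_distrib, auxPerm_sign]
        congr 1
        · push_cast; rfl
        · refine Finset.prod_congr rfl fun i _ => ?_
          rw [if_pos]
          · rfl
          · simp only [auxPerm_apply]
            have : q.2 i true ≠ q.2 i false := by simp
            revert this
            cases q.2 i true <;> cases q.2 i false <;> simp
    rw [Fintype.sum_prod_type] at hre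
    have hin : ∀ τ : Equiv.Perm (Fin n), ∑ ε : Fin n → Equiv.Perm Bool,
        ∏ i, (((Equiv.Perm.sign (ε i) : ℤ) : ZMod p) *
          (-(auxE n (τ i, ε i true) : ZMod p) * d i))
        = (∏ j : Fin n, -((2 * n - 1 - 2 * j : ℕ) : ZMod p)) * ∏ i, d i := by
      intro τ
      have h0 := Finset.prod_univ_sum (fun _ : Fin n => (Finset.univ : Finset (Equiv.Perm Bool)))
        (fun i e => (((Equiv.Perm.sign e : ℤ) : ZMod p) *
          (-(auxE n (τ i, e true) : ZMod p) * d i)))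
      rw [Fintype.piFinset_univ] at h0
      rw [← h0, ← Equiv.prod_comp τ (fun j : Fin n => -((2 * n - 1 - 2 * j : ℕ) : ZMod p)), ← Finset.prod_mul_distrib]
      refine Finset.prod_congr rfl fun i _ => ?_
      rw [auxBoolSum (fun b => -(auxE n (τ i, b) : ZMod p) * d i)]
      have h4 : auxE n (τ i, true) = (2 * n - 1 - 2 * (τ i : ℕ)) + auxE n (τ i, false) := by
        have := (τ i).2
        simp [auxE]; omega
      rw [h4]; push_cast; ring
    simp only [hin] at hre
    rw [Finset.sum_const, nsmul_eq_mul, Finset.card_univ, Fintype.card_perm, Fintype.card_fin] at hre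
    have hp : p.Prime := Fact.out
    rcases mul_eq_zero.1 hre with h | h
    · rw [ZMod.natCast_eq_zero_iff, hp.dvd_factorial] at h
      omega
    · rcases mul_eq_zero.1 h with h | h
      · obtain ⟨j, _, hj⟩ := Finset.prod_eq_zero_iff.1 h
        rw [neg_eq_zero, ZMod.natCast_eq_zero_iff] at hj
        have := j.2
        have := Nat.le_of_dvd (by omega) hj
        omega
      · obtain ⟨j, _, hj⟩ := Finset.prod_eq_zero_iff.1 h
        exact hd j hj
  obtain ⟨x, hx⟩ := key
  have hv : Function.Injective (v x) := by
    intro r s hrs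
    by_contra hne
    apply hx
    rw [hNL, Matrix.det_mul, Matrix.det_zero_of_row_eq hne (M := V x), mul_zero]
    funext c
    simp [V, hrs]
  refine ⟨x, ?_⟩
  have h5 : Sum.elim x (fun i => x i + d i) =
      v x ∘ Sum.elim (fun i => (i, false)) (fun i => (i, true)) := by
    funext s
    cases s <;> simp [v]
  rw [h5]
  refine hv.comp ?_
  rintro (a | a) (b | b) <;> simp

theorem pairing_strategy_one_dim (n p : ℕ) (hp : p.Prime) (hpn : 2 * n + 1 ≤ p)
    (d : Fin n → ℤ) (hpd : ∀ i, ¬ (p : ℤ) ∣ d i) :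
    ∃ x y : Fin n → ℤ,
      Function.Injective (Sum.elim (fun i => ((x i : ZMod p))) (fun i => ((y i : ZMod p)))) ∧
      (∀ i, ((x i + d i : ℤ) : ZMod p) = ((y i : ℤ) : ZMod p)) ∧
      ∀ π : ℤ → ℤ,
        (∀ z : ℤ, ∀ i, ((z : ZMod p) = (x i : ZMod p)) → π z = z + d i) →
        (∀ z : ℤ, ∀ i, ((z : ZMod p) = (y i : ZMod p)) → π z = z - d i) →
        ∀ i, ∀ a : ℤ, ∃ j : ℕ, j < p ∧ π (a + j * d i) = a + (j + 1) * d i := by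
  haveI : Fact p.Prime := ⟨hp⟩
  have hd : ∀ i, ((d i : ℤ) : ZMod p) ≠ 0 := fun i h =>
    hpd i ((ZMod.intCast_zmod_eq_zero_iff_dvd _ _).1 h)
  obtain ⟨x, hx⟩ := aux_main n hpn (fun i => (d i : ZMod p)) hd
  refine ⟨fun i => ((x i).val : ℤ), fun i => ((x i).val : ℤ) + d i, ?_, fun i => rfl, ?_⟩
  · simpa using hx
  · intro π h1 _ i a
    refine ⟨((x i - a) / (d i : ZMod p)).val, ZMod.val_lt _, ?_⟩
    rw [h1 _ i]
    · ring
    · have := hd i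
      simp
      rw [div_mul_cancel₀ _ this]; ring
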